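/- Let ε be a splitting on an open set U ⊆ ℝⁿ. Then for all x ∈ U and all indices i,j,k,r: ∇_r T^i_{jk}(x) = 𝔯^i_{jk,r}(x); explicitly, ∂T^i_{jk}/∂x^r − Γ^i_{ra}T^a_{jk} + Γ^a_{rj}T^i_{ak} + Γ^a_{rk}T^i_{ja} = ∂Γ^i_{rk}/∂x^j + Γ^a_{rj}Γ^i_{ak} − ∂Γ^i_{rj}/∂x^k − Γ^a_{rk}Γ^i_{aj}. -/

import Mathlib

noncomputable section

open Set

/-- The `j`-th coordinate partial derivative of a real-valued function on `ℝⁿ`. -/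
noncomputable def pd {n : ℕ} (j : Fin n) (f : (Fin n → ℝ) → ℝ) (x : Fin n → ℝ) : ℝ :=
  fderiv ℝ f x (Pi.single j 1)

/-- A splitting `ε` on `U`: a smooth groupoid homomorphism `U × U → GL(n,ℝ)`
satisfying `ε(z,y)ε(x,z) = ε(x,y)` and `ε(x,x) = id`. -/
structure IsSplitting {n : ℕ} (U : Set (Fin n → ℝ))
    (eps : (Fin n → ℝ) → (Fin n → ℝ) → Fin n → Fin n → ℝ) : Prop where
  smooth : ∀ i j : Fin n, ContDiffOn ℝ (⊤ : ℕ∞)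
    (fun p : (Fin n → ℝ) × (Fin n → ℝ) => eps p.1 p.2 i j) (U ×ˢ U)
  comp : ∀ x ∈ U, ∀ y ∈ U, ∀ z ∈ U, ∀ i j : Fin n,
    (∑ a, eps z y i a * eps x z a j) = eps x y i j
  refl : ∀ x ∈ U, ∀ i j : Fin n, eps x x i j = if i = j then (1 : ℝ) else 0

/-- `Γ^i_{jk}(x) = (∂ε^i_k(x,y)/∂y^j)|_{y=x}`. -/
noncomputable def Gam {n : ℕ} (eps : (Fin n → ℝ) → (Fin n → ℝ) → Fin n → Fin n → ℝ)
    (i j k : Fin n) (x : Fin n → ℝ) : ℝ :=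
  pd j (fun y => eps x y i k) x

/-- The groupoid curvature `R^i_{jk}(x,y)`. -/
noncomputable def Rg {n : ℕ} (eps : (Fin n → ℝ) → (Fin n → ℝ) → Fin n → Fin n → ℝ)
    (i j k : Fin n) (x y : Fin n → ℝ) : ℝ :=
  pd j (fun x' => eps x' y i k) x + ∑ a, pd a (fun y' => eps x y' i k) y * eps x y a j
    - pd k (fun x' => eps x' y i j) x - ∑ a, pd a (fun y' => eps x y' i j) y * eps x y a k

/-- The algebroid curvature `𝔯^i_{jk,r}(x)`. -/
noncomputable def ra {n : ℕ} (eps : (Fin n → ℝ) → (Fin n → ℝ) → Fin n → Fin n → ℝ)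
    (i j k r : Fin n) (x : Fin n → ℝ) : ℝ :=
  pd j (Gam eps i r k) x + ∑ a, Gam eps a r j x * Gam eps i a k x
    - pd k (Gam eps i r j) x - ∑ a, Gam eps a r k x * Gam eps i a j x

/-- The torsion `T^i_{jk} = Γ^i_{jk} − Γ^i_{kj}`. -/
noncomputable def Tor {n : ℕ} (eps : (Fin n → ℝ) → (Fin n → ℝ) → Fin n → Fin n → ℝ)
    (i j k : Fin n) (x : Fin n → ℝ) : ℝ :=
  Gam eps i j k x - Gam eps i k j x

/-- A vector field `ξ` is `ε`-parallel if `ξ^i(y) = ε^i_a(x,y) ξ^a(x)` for all `x, y ∈ U`. -/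
def EpsParallelVF {n : ℕ} (U : Set (Fin n → ℝ))
    (eps : (Fin n → ℝ) → (Fin n → ℝ) → Fin n → Fin n → ℝ)
    (ξ : (Fin n → ℝ) → Fin n → ℝ) : Prop :=
  ∀ x ∈ U, ∀ y ∈ U, ∀ i, ξ y i = ∑ a, eps x y i a * ξ x a

/-- Coordinate partial derivatives of a `C²` function commute. -/
theorem pd_comm {n : ℕ} {f : (Fin n → ℝ) → ℝ} {x : Fin n → ℝ} (hf : ContDiffAt ℝ 2 f x)
    (j r : Fin n) : pd j (pd r f) x = pd r (pd j f) x := by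
  have hd : DifferentiableAt ℝ (fderiv ℝ f) x :=
    (hf.fderiv_right (m := 1) (by norm_num)).differentiableAt (by norm_num)
  have hsymm : IsSymmSndFDerivAt ℝ f x := hf.isSymmSndFDerivAt (by simp)
  have key : ∀ s t : Fin n,
      pd s (pd t f) x = fderiv ℝ (fderiv ℝ f) x (Pi.single s 1) (Pi.single t 1) := by
    intro s t
    unfold pd
    rw [fderiv_clm_apply hd (differentiableAt_const _)]
    simp
  rw [key, key, hsymm.eq]

theorem differentiableAt_pd {n : ℕ} {f : (Fin n → ℝ) → ℝ} {x : Fin n → ℝ}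
    (hf : ContDiffAt ℝ 2 f x) (j : Fin n) : DifferentiableAt ℝ (pd j f) x :=
  ((hf.fderiv_right (m := 1) (by norm_num)).differentiableAt (by norm_num)).clm_apply
    (differentiableAt_const _)

theorem pd_congr {n : ℕ} {f g : (Fin n → ℝ) → ℝ} {x : Fin n → ℝ} (h : f =ᶠ[nhds x] g)
    (j : Fin n) : pd j f x = pd j g x := by
  simp only [pd, h.fderiv_eq]

theorem pd_sum_mul {n : ℕ} {ι : Type*} [Fintype ι] {f g : ι → (Fin n → ℝ) → ℝ}
    {x : Fin n → ℝ} (hf : ∀ a, DifferentiableAt ℝ (f a) x)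
    (hg : ∀ a, DifferentiableAt ℝ (g a) x) (j : Fin n) :
    pd j (fun y => ∑ a, f a y * g a y) x = ∑ a, (pd j (f a) x * g a x + f a x * pd j (g a) x) := by
  unfold pd
  rw [fderiv_fun_sum fun a _ => (hf a).fun_mul (hg a), sum_apply]
  refine Finset.sum_congr rfl fun a _ => ?_
  rw [fderiv_fun_mul (hf a) (hg a)]
  simp only [add_apply, smul_apply, smul_eq_mul]
  ring

namespace IsSplitting

variable {n : ℕ} {U : Set (Fin n → ℝ)} {eps : (Fin n → ℝ) → (Fin n → ℝ) → Fin n → Fin n → ℝ}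

theorem contDiffAt_right (heps : IsSplitting U eps) (hU : IsOpen U) {x y : Fin n → ℝ}
    (hx : x ∈ U) (hy : y ∈ U) (i k : Fin n) :
    ContDiffAt ℝ (⊤ : ℕ∞) (fun z => eps x z i k) y :=
  ((heps.smooth i k).contDiffAt ((hU.prod hU).mem_nhds ⟨hx, hy⟩)).comp y
    (contDiffAt_const.prodMk contDiffAt_id)

theorem contDiffAt_left (heps : IsSplitting U eps) (hU : IsOpen U) {x y : Fin n → ℝ}
    (hx : x ∈ U) (hy : y ∈ U) (i k : Fin n) :
    ContDiffAt ℝ (⊤ : ℕ∞) (fun z => eps z y i k) x :=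
  ((heps.smooth i k).contDiffAt ((hU.prod hU).mem_nhds ⟨hx, hy⟩)).comp x
    (contDiffAt_id.prodMk contDiffAt_const)

theorem pd_right_eq (heps : IsSplitting U eps) (hU : IsOpen U) {x y w : Fin n → ℝ}
    (hx : x ∈ U) (hy : y ∈ U) (hw : w ∈ U) (i r k : Fin n) :
    pd r (fun z => eps x z i k) y = ∑ a, pd r (fun z => eps w z i a) y * eps x w a k := by
  have h : (fun z => eps x z i k) =ᶠ[nhds y] fun z => ∑ a, eps w z i a * eps x w a k := by
    filter_upwards [hU.mem_nhds hy] with z hz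
    exact (heps.comp x hx z hz w hw i k).symm
  rw [pd_congr h, pd_sum_mul
    (fun a => (heps.contDiffAt_right hU hw hy i a).differentiableAt (by simp))
    (fun a => differentiableAt_const _)]
  simp [pd]

theorem differentiableAt_Gam (heps : IsSplitting U eps) (hU : IsOpen U) {x : Fin n → ℝ}
    (hx : x ∈ U) (i r k : Fin n) : DifferentiableAt ℝ (Gam eps i r k) x := by
  have h : Gam eps i r k =ᶠ[nhds x]
      fun y => ∑ a, pd r (fun z => eps x z i a) y * eps y x a k := by
    filter_upwards [hU.mem_nhds hx] with y hy
    exact heps.pd_right_eq hU hy hy hx i r k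
  refine DifferentiableAt.congr_of_eventuallyEq (DifferentiableAt.fun_sum fun a _ => ?_) h
  exact (differentiableAt_pd ((heps.contDiffAt_right hU hx hx i a).of_le
    (WithTop.coe_le_coe.mpr le_top)) r).mul
    ((heps.contDiffAt_left hU hx hx a k).differentiableAt (by simp))

theorem pd_pd_right (heps : IsSplitting U eps) (hU : IsOpen U) {x : Fin n → ℝ}
    (hx : x ∈ U) (i j r k : Fin n) :
    pd j (pd r (fun z => eps x z i k)) x =
      pd j (Gam eps i r k) x + ∑ a, Gam eps i r a x * Gam eps a j k x := by
  have h : pd r (fun z => eps x z i k) =ᶠ[nhds x]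
      fun y => ∑ a, Gam eps i r a y * eps x y a k := by
    filter_upwards [hU.mem_nhds hx] with y hy
    exact heps.pd_right_eq hU hx hy hy i r k
  rw [pd_congr h, pd_sum_mul (fun a => heps.differentiableAt_Gam hU hx i r a)
    (fun a => (heps.contDiffAt_right hU hx hx a k).differentiableAt (by simp)),
    Finset.sum_add_distrib]
  simp [heps.refl x hx, Gam]

/-- The linear connection with coefficients `Γ` is flat. -/
theorem pd_Gam_flat (heps : IsSplitting U eps) (hU : IsOpen U) {x : Fin n → ℝ}
    (hx : x ∈ U) (i j r k : Fin n) :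
    pd j (Gam eps i r k) x + ∑ a, Gam eps i r a x * Gam eps a j k x =
      pd r (Gam eps i j k) x + ∑ a, Gam eps i j a x * Gam eps a r k x := by
  rw [← heps.pd_pd_right hU hx, ← heps.pd_pd_right hU hx]
  exact pd_comm ((heps.contDiffAt_right hU hx hx i k).of_le (WithTop.coe_le_coe.mpr le_top)) j r

end IsSplitting

/-- `∇_r T^i_{jk} = 𝔯^i_{jk,r}`, explicitly
`∂T^i_{jk}/∂x^r − Γ^i_{ra}T^a_{jk} + Γ^a_{rj}T^i_{ak} + Γ^a_{rk}T^i_{ja}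
  = ∂Γ^i_{rk}/∂x^j + Γ^a_{rj}Γ^i_{ak} − ∂Γ^i_{rj}/∂x^k − Γ^a_{rk}Γ^i_{aj}`. -/
theorem stmt_8 {n : ℕ} (hn : 2 ≤ n) (U : Set (Fin n → ℝ)) (hU : IsOpen U)
    (eps : (Fin n → ℝ) → (Fin n → ℝ) → Fin n → Fin n → ℝ) (heps : IsSplitting U eps) :
    ∀ x ∈ U, ∀ i j k r : Fin n,
      pd r (Tor eps i j k) x - ∑ a, Gam eps i r a x * Tor eps a j k x
          + ∑ a, Gam eps a r j x * Tor eps i a k x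
          + ∑ a, Gam eps a r k x * Tor eps i j a x =
        pd j (Gam eps i r k) x + ∑ a, Gam eps a r j x * Gam eps i a k x
          - pd k (Gam eps i r j) x - ∑ a, Gam eps a r k x * Gam eps i a j x := by
  intro x hx i j k r
  have hT : pd r (Tor eps i j k) x = pd r (Gam eps i j k) x - pd r (Gam eps i k j) x := by
    have : Tor eps i j k = fun y => Gam eps i j k y - Gam eps i k j y := rfl
    simp only [pd, this]
    rw [fderiv_fun_sub (heps.differentiableAt_Gam hU hx i j k)
      (heps.differentiableAt_Gam hU hx i k j), sub_apply]
  have h₁ := heps.pd_Gam_flat hU hx i j r k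
  have h₂ := heps.pd_Gam_flat hU hx i k r j
  rw [hT]
  simp only [Tor, mul_sub, Finset.sum_sub_distrib]
  simp only [mul_comm (Gam eps _ r j x), mul_comm (Gam eps _ r k x)] at h₁ h₂ ⊢
  linarith
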